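/- arXiv:1805.08049 — 2 statements merged into one kernel-verified Lean document; each statement's English description precedes it below -/
import Mathlib

section
/- Let O be an integral domain, p a prime number, h ≥ 1, q = p^h, and π ∈ O a nonzero element such that p ∈ πO and a^q ≡ a (mod πO) for every a ∈ O. Then there exists a unique sequence of polynomials (F_n)_{n ≥ 0} in the polynomial ring O[X_0, X_1, X_2, …] such that Φ^{(π,q)}_n(F_0, …, F_n) = Φ^{(π,q)}_{n+1}(X_0, …, X_{n+1}) for all n ≥ 0. (This family defines the Frobenius endomorphism of the scheme of ramified Witt vectors over O.) -/
open MvPolynomial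

/-- The `n`-th ramified Witt polynomial with respect to `(π, q)`,
evaluated at a sequence `b`: `Φ^{(π,q)}_n(b) = ∑_{i=0}^{n} π^i b_i^{q^{n-i}}`. -/
def wittPhi {R : Type*} [CommRing R] (π : R) (q : ℕ) (n : ℕ) (b : ℕ → R) : R :=
  ∑ i ∈ Finset.range (n + 1), π ^ i * b i ^ q ^ (n - i)

theorem wittPhi_eq_sum_add {R : Type*} [CommRing R] (π : R) (q n : ℕ) (b : ℕ → R) :
    wittPhi π q n b = ∑ i ∈ Finset.range n, π ^ i * b i ^ q ^ (n - i) + π ^ n * b n := by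
  simp [wittPhi, Finset.sum_range_succ]

theorem wittPhi_succ {R : Type*} [CommRing R] (π : R) (q n : ℕ) (b : ℕ → R) :
    wittPhi π q (n + 1) b = wittPhi π q n (fun i => b i ^ q) + π ^ (n + 1) * b (n + 1) := by
  rw [wittPhi_eq_sum_add, wittPhi]
  congr 1
  refine Finset.sum_congr rfl fun i hi => ?_
  rw [Finset.mem_range] at hi
  rw [← pow_mul, ← pow_succ', Nat.sub_add_comm (by lia)]

theorem map_wittPhi {R S : Type*} [CommRing R] [CommRing S] (f : R →+* S) (π : R) (q n : ℕ)
    (b : ℕ → R) : f (wittPhi π q n b) = wittPhi (f π) q n (fun i => f (b i)) := by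
  simp [wittPhi]

/-- Over a domain, with `π` nonzero, a sequence is determined by its Witt polynomials. -/
theorem wittPhi_injective {R : Type*} [CommRing R] [IsDomain R] {π : R} (hπ : π ≠ 0) {q : ℕ}
    {b c : ℕ → R} (hbc : ∀ n, wittPhi π q n b = wittPhi π q n c) : b = c := by
  funext n
  induction n using Nat.strong_induction_on with
  | _ n ih =>
    have key := hbc n
    rw [wittPhi_eq_sum_add, wittPhi_eq_sum_add, Finset.sum_congr rfl fun i hi => by
      rw [ih i (Finset.mem_range.mp hi)]] at key
    exact mul_left_cancel₀ (pow_ne_zero n hπ) (add_left_cancel key)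

theorem pow_succ_dvd_pow_sub_pow {R : Type*} [CommRing R] {π : R} {q : ℕ} (hq : π ∣ (q : R))
    {x y : R} (hxy : π ∣ x - y) (k : ℕ) : π ^ (k + 1) ∣ x ^ q ^ k - y ^ q ^ k := by
  induction k with
  | zero => simpa using hxy
  | succ k ih =>
    have hdvd : π ∣ x ^ q ^ k - y ^ q ^ k := (dvd_pow_self π k.succ_ne_zero).trans ih
    rw [pow_succ q k, pow_mul, pow_mul, ← geom_sum₂_mul, pow_succ' π (k + 1)]
    exact mul_dvd_mul ((dvd_geom_sum₂_iff_of_dvd_sub hdvd).mpr (hq.mul_right _)) ih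

theorem pow_succ_dvd_wittPhi_sub {R : Type*} [CommRing R] {π : R} {q : ℕ} (hq : π ∣ (q : R))
    {b c : ℕ → R} {n : ℕ} (hbc : ∀ i ≤ n, π ∣ b i - c i) :
    π ^ (n + 1) ∣ wittPhi π q n b - wittPhi π q n c := by
  rw [wittPhi, wittPhi, ← Finset.sum_sub_distrib]
  refine Finset.dvd_sum fun i hi => ?_
  have hin : i ≤ n := Nat.lt_succ_iff.mp (Finset.mem_range.mp hi)
  rw [← mul_sub, show n + 1 = i + (n - i + 1) by lia, pow_add]
  exact mul_dvd_mul_left _ (pow_succ_dvd_pow_sub_pow hq (hbc i hin) _)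

/-- A sequence obtained by successively solving `wittPhi π q n b = w n` for `b n`,
whenever a solution exists. -/
noncomputable def wittLift {R : Type*} [CommRing R] (π : R) (q : ℕ) (w : ℕ → R) : ℕ → R
  | n => Classical.epsilon fun c =>
      w n = ∑ i : Fin n, π ^ (i : ℕ) * wittLift π q w i ^ q ^ (n - i) + π ^ n * c

theorem wittPhi_wittLift {R : Type*} [CommRing R] {π : R} {q : ℕ} {w : ℕ → R} {n : ℕ}
    (hn : π ^ n ∣ w n - ∑ i ∈ Finset.range n, π ^ i * wittLift π q w i ^ q ^ (n - i)) :
    wittPhi π q n (wittLift π q w) = w n := by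
  obtain ⟨c, hc⟩ := hn
  have hex : ∃ c, w n =
      ∑ i : Fin n, π ^ (i : ℕ) * wittLift π q w i ^ q ^ (n - i) + π ^ n * c := by
    refine ⟨c, ?_⟩
    rw [Fin.sum_univ_eq_sum_range (fun i => π ^ i * wittLift π q w i ^ q ^ (n - i)), ← hc]
    ring
  have hspec := Classical.epsilon_spec hex
  rw [← wittLift,
    Fin.sum_univ_eq_sum_range (fun i => π ^ i * wittLift π q w i ^ q ^ (n - i))] at hspec
  rw [wittPhi_eq_sum_add, ← hspec]

/-- Dwork's lemma: given a lift `σ` of the `q`-power map modulo `π`, a sequence `w` with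
`w (n + 1) ≡ σ (w n)` modulo `π ^ (n + 1)` is a sequence of values of Witt polynomials. -/
theorem exists_wittPhi_eq {R : Type*} [CommRing R] {π : R} {q : ℕ} (hq : π ∣ (q : R))
    (σ : R →+* R) (hσπ : σ π = π) (hσ : ∀ x, π ∣ σ x - x ^ q) {w : ℕ → R}
    (hw : ∀ n, π ^ (n + 1) ∣ w (n + 1) - σ (w n)) :
    ∃ b : ℕ → R, ∀ n, wittPhi π q n b = w n := by
  refine ⟨wittLift π q w, fun n => ?_⟩
  induction n with
  | zero => exact wittPhi_wittLift (by simp)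
  | succ n ih =>
    refine wittPhi_wittLift ?_
    have hsum := wittPhi_succ π q n (wittLift π q w)
    rw [wittPhi_eq_sum_add, add_left_inj] at hsum
    have hstep := hw n
    rw [← ih, map_wittPhi, hσπ] at hstep
    rw [hsum]
    simpa using dvd_add hstep (pow_succ_dvd_wittPhi_sub hq fun i _ => hσ (wittLift π q w i))

theorem C_dvd_expand_sub_pow {O ι : Type*} [CommRing O] {p : ℕ} (hp : p.Prime) {h : ℕ} {π : O}
    (hpπ : π ∣ (p : O)) (hO : ∀ a : O, π ∣ a ^ p ^ h - a) (f : MvPolynomial ι O) :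
    C π ∣ expand (p ^ h) f - f ^ p ^ h := by
  induction f using MvPolynomial.induction_on with
  | C a =>
    rw [expand_C, ← C_pow, ← C_sub]
    exact map_dvd C (dvd_sub_comm.mp (hO a))
  | add f g hf hg =>
    obtain ⟨r, hr⟩ := exists_add_pow_prime_pow_eq hp f g h
    have hpC : (C π : MvPolynomial ι O) ∣ (p : MvPolynomial ι O) := by
      simpa using map_dvd (C : O →+* MvPolynomial ι O) hpπ
    rw [map_add, hr]
    convert dvd_sub (dvd_add hf hg) (hpC.mul_right (f * g * r)) using 1
    ring
  | mul_X f i hf =>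
    rw [map_mul, expand_X, mul_pow, ← sub_mul]
    exact hf.mul_right _

theorem stmt_3 {O : Type*} [CommRing O] [IsDomain O] (p : ℕ) (hp : p.Prime)
    (h : ℕ) (hh : 1 ≤ h) (q : ℕ) (hq : q = p ^ h) (π : O) (hπ : π ≠ 0)
    (hpπ : (p : O) ∈ Ideal.span {π})
    (hO : ∀ a : O, a ^ q - a ∈ Ideal.span {π}) :
    ∃! F : ℕ → MvPolynomial ℕ O,
      ∀ n : ℕ, wittPhi (MvPolynomial.C π) q n F
        = wittPhi (MvPolynomial.C π) q (n + 1) (fun i => MvPolynomial.X i) := by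
  subst hq
  rw [Ideal.mem_span_singleton] at hpπ
  simp only [Ideal.mem_span_singleton] at hO
  have hq : (C π : MvPolynomial ℕ O) ∣ ((p ^ h : ℕ) : MvPolynomial ℕ O) := by
    have hpow : π ∣ ((p ^ h : ℕ) : O) := by
      rw [Nat.cast_pow]
      exact dvd_pow hpπ (by lia)
    simpa using map_dvd (C : O →+* MvPolynomial ℕ O) hpow
  obtain ⟨F, hF⟩ := exists_wittPhi_eq
    (w := fun n => wittPhi (C π) (p ^ h) (n + 1) (fun i => (X i : MvPolynomial ℕ O))) hq
    (expand (p ^ h) : MvPolynomial ℕ O →ₐ[O] MvPolynomial ℕ O).toRingHom (expand_C _ _)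
    (C_dvd_expand_sub_pow hp hpπ hO) fun n => by
      rw [map_wittPhi, wittPhi_succ _ _ (n + 1)]
      exact ⟨C π * X (n + 2), by simp; ring⟩
  exact ⟨F, hF, fun G hG => wittPhi_injective (C_ne_zero.mpr hπ)
    fun n => (hG n).trans (hF n).symm⟩
end

section
/- Let O' be an integral domain, p a prime number, h ≥ 1, q = p^h, r ≥ 1 an integer, and let ϖ, π ∈ O' be elements with ϖ ≠ 0, p ∈ ϖO', π ∈ ϖO', and a^{q^r} ≡ a (mod ϖO') for every a ∈ O'. Then there exists a unique sequence of polynomials (u_n)_{n ≥ 0} in the polynomial ring O'[X_0, X_1, X_2, …] such that Φ^{(ϖ,q^r)}_m(u_0, …, u_m) = Φ^{(π,q)}_{rm}(X_0, …, X_{rm}) for all m ≥ 0. (This family defines the Drinfeld morphism between schemes of ramified Witt vectors.) -/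
open MvPolynomial

theorem pow_succ_dvd_sub_pow_pow {R : Type*} [CommRing R] {p : ℕ} {c a b : R}
    (hpc : c ∣ (p : R)) (hab : c ∣ a - b) (k : ℕ) :
    c ^ (k + 1) ∣ a ^ p ^ k - b ^ p ^ k := by
  induction k with
  | zero => simpa using hab
  | succ k ih =>
    have hquot : Ideal.Quotient.mk (Ideal.span {c}) (a ^ p ^ k)
        = Ideal.Quotient.mk (Ideal.span {c}) (b ^ p ^ k) := by
      rw [Ideal.Quotient.mk_eq_mk_iff_sub_mem, Ideal.mem_span_singleton]
      exact (dvd_pow_self c k.succ_ne_zero).trans ih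
    have hgeom : c ∣ ∑ i ∈ Finset.range p, (a ^ p ^ k) ^ i * (b ^ p ^ k) ^ (p - 1 - i) := by
      rw [← Ideal.mem_span_singleton, ← Ideal.Quotient.eq_zero_iff_mem]
      simp only [map_sum, map_mul, map_pow (Ideal.Quotient.mk (Ideal.span {c})) (_ ^ p ^ k), hquot]
      have hsum : ∀ i ∈ Finset.range p, (Ideal.Quotient.mk (Ideal.span {c}) (b ^ p ^ k)) ^ i
          * (Ideal.Quotient.mk (Ideal.span {c}) (b ^ p ^ k)) ^ (p - 1 - i)
          = (Ideal.Quotient.mk (Ideal.span {c}) (b ^ p ^ k)) ^ (p - 1) := by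
        intro i hi
        rw [← pow_add]
        congr 1
        have := Finset.mem_range.1 hi
        omega
      have hp0 : (p : R ⧸ Ideal.span {c}) = 0 := by
        rw [← map_natCast (Ideal.Quotient.mk (Ideal.span {c})), Ideal.Quotient.eq_zero_iff_mem]
        exact Ideal.mem_span_singleton.2 hpc
      rw [Finset.sum_congr rfl hsum, Finset.sum_const, Finset.card_range, nsmul_eq_mul, hp0,
        zero_mul]
    rw [pow_succ p, pow_mul, pow_mul, ← (Commute.all _ _).geom_sum₂_mul, mul_comm, pow_succ c]
    exact mul_dvd_mul ih hgeom

theorem wittPhi_eq_sum_fin_add {R : Type*} [CommRing R] (c : R) (Q n : ℕ) (b : ℕ → R) :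
    wittPhi c Q n b = ∑ i : Fin n, c ^ (i : ℕ) * b i ^ Q ^ (n - i) + c ^ n * b n := by
  rw [Fin.sum_univ_eq_sum_range (fun i => c ^ i * b i ^ Q ^ (n - i))]
  simp [wittPhi, Finset.sum_range_succ _ n]

theorem wittPhi_injective_s5 {R : Type*} [CommRing R] [IsDomain R] {c : R} (hc : c ≠ 0) (Q : ℕ)
    {u v : ℕ → R} (huv : ∀ n, wittPhi c Q n u = wittPhi c Q n v) : u = v := by
  funext n
  induction n using Nat.strong_induction_on with
  | _ n ih =>
    have hn := huv n
    rw [wittPhi_eq_sum_fin_add, wittPhi_eq_sum_fin_add,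
      Finset.sum_congr rfl fun i _ => by rw [ih i i.2]] at hn
    exact mul_left_cancel₀ (pow_ne_zero n hc) (add_left_cancel hn)

/-- A sequence whose `n`-th ramified Witt polynomial is `G n`, as long as the required divisions
by powers of `c` are possible. -/
noncomputable def ofGhost {R : Type*} [CommRing R] (c : R) (Q : ℕ) (G : ℕ → R) (n : ℕ) : R :=
  Classical.epsilon fun y =>
    G n = ∑ i : Fin n, c ^ (i : ℕ) * ofGhost c Q G i ^ Q ^ (n - i) + c ^ n * y
termination_by n
decreasing_by exact i.2

theorem wittPhi_ofGhost {R : Type*} [CommRing R] {c : R} {Q : ℕ} {G : ℕ → R} {n : ℕ}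
    (hn : ∃ y, G n = ∑ i : Fin n, c ^ (i : ℕ) * ofGhost c Q G i ^ Q ^ (n - i) + c ^ n * y) :
    wittPhi c Q n (ofGhost c Q G) = G n := by
  rw [wittPhi_eq_sum_fin_add]
  conv_lhs => arg 2; rw [ofGhost]
  exact (Classical.epsilon_spec hn).symm

/-- Dwork's lemma for ramified Witt polynomials. -/
theorem exists_wittPhi_eq_s5 {R : Type*} [CommRing R] {p k : ℕ} (hk : 1 ≤ k) {c : R}
    (hpc : c ∣ (p : R)) (σ : R →+* R) (hσc : σ c = c) (hσ : ∀ x, c ∣ x ^ p ^ k - σ x)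
    {G : ℕ → R} (hG : ∀ n, c ^ (n + 1) ∣ G (n + 1) - σ (G n)) :
    ∃ u : ℕ → R, ∀ n, wittPhi c (p ^ k) n u = G n := by
  refine ⟨ofGhost c (p ^ k) G, fun n => ?_⟩
  induction n with
  | zero => exact wittPhi_ofGhost ⟨G 0, by simp⟩
  | succ n ih =>
    apply wittPhi_ofGhost
    set u := ofGhost c (p ^ k) G
    have hdiff : c ^ (n + 1) ∣
        σ (G n) - ∑ i ∈ Finset.range (n + 1), c ^ i * u i ^ (p ^ k) ^ (n + 1 - i) := by
      rw [← ih, wittPhi, map_sum, ← Finset.sum_sub_distrib]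
      refine Finset.dvd_sum fun i hi => ?_
      have hin : i ≤ n := Nat.lt_succ_iff.1 (Finset.mem_range.1 hi)
      rw [map_mul, map_pow, map_pow, hσc, ← mul_sub, Nat.succ_sub hin, pow_succ' (p ^ k),
        pow_mul (u i), ← pow_mul p]
      have hle : n + 1 ≤ i + (k * (n - i) + 1) := by
        have := Nat.mul_le_mul_right (n - i) hk
        omega
      refine (pow_dvd_pow c hle).trans ?_
      rw [pow_add]
      exact mul_dvd_mul_left _
        (pow_succ_dvd_sub_pow_pow hpc ((dvd_sub_comm).1 (hσ (u i))) _)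
    obtain ⟨y, hy⟩ := dvd_add (hG n) hdiff
    refine ⟨y, ?_⟩
    rw [Fin.sum_univ_eq_sum_range (fun i => c ^ i * u i ^ (p ^ k) ^ (n + 1 - i)), ← hy]
    ring

theorem MvPolynomial.C_dvd_pow_sub_expand {R σ : Type*} [CommRing R] {p k : ℕ} (hp : p.Prime)
    {c : R} (hpc : c ∣ (p : R)) (hc : ∀ a : R, c ∣ a ^ p ^ k - a) (f : MvPolynomial σ R) :
    C c ∣ f ^ p ^ k - expand (p ^ k) f := by
  induction f using MvPolynomial.induction_on with
  | C a =>
    rw [expand_C, ← C_pow, ← C_sub]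
    exact map_dvd C (hc a)
  | add f g hf hg =>
    obtain ⟨s, hs⟩ := exists_add_pow_prime_pow_eq hp f g k
    have hpC : (C c : MvPolynomial σ R) ∣ (p : MvPolynomial σ R) := by
      simpa using map_dvd (C : R →+* MvPolynomial σ R) hpc
    have hsplit : (f + g) ^ p ^ k - expand (p ^ k) (f + g)
        = (f ^ p ^ k - expand (p ^ k) f) + (g ^ p ^ k - expand (p ^ k) g)
          + p * (f * g * s) := by
      rw [hs, map_add]
      ring
    rw [hsplit]
    exact dvd_add (dvd_add hf hg) (hpC.mul_right _)
  | mul_X f i hf =>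
    rw [map_mul, expand_X, mul_pow, ← sub_mul]
    exact hf.mul_right _

theorem C_pow_dvd_wittPhi_X_sub_expand {R : Type*} [CommRing R] {ϖ π : R} (hπ : ϖ ∣ π)
    (q : ℕ) {r : ℕ} (hr : 1 ≤ r) (n : ℕ) :
    (C ϖ : MvPolynomial ℕ R) ^ (n + 1) ∣ wittPhi (C π) q (r * (n + 1)) (fun i => X i)
      - expand (q ^ r) (wittPhi (C π) q (r * n) fun i => X i) := by
  have hexpand : expand (q ^ r) (wittPhi (C π) q (r * n) fun i => (X i : MvPolynomial ℕ R))
      = ∑ i ∈ Finset.range (r * n + 1), C π ^ i * X i ^ q ^ (r * (n + 1) - i) := by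
    rw [wittPhi, map_sum]
    refine Finset.sum_congr rfl fun i hi => ?_
    have hi' : r * (n + 1) - i = r + (r * n - i) := by
      have := Finset.mem_range.1 hi
      rw [mul_add_one]
      omega
    rw [map_mul, map_pow, map_pow, expand_C, expand_X, hi', pow_add q, pow_mul]
  have hlen : r * (n + 1) + 1 = r * n + 1 + r := by ring
  rw [hexpand, wittPhi, hlen, Finset.sum_range_add _ (r * n + 1), add_sub_cancel_left]
  refine Finset.dvd_sum fun i _ => Dvd.dvd.mul_right ?_ _
  have hle : n + 1 ≤ r * n + 1 + i := by
    have := Nat.mul_le_mul_right n hr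
    omega
  exact (pow_dvd_pow _ hle).trans (pow_dvd_pow_of_dvd (map_dvd C hπ) _)

theorem stmt_5 {O' : Type*} [CommRing O'] [IsDomain O'] (p : ℕ) (hp : p.Prime)
    (h : ℕ) (hh : 1 ≤ h) (q : ℕ) (hq : q = p ^ h) (r : ℕ) (hr : 1 ≤ r)
    (ϖ π : O') (hϖ : ϖ ≠ 0)
    (hpϖ : (p : O') ∈ Ideal.span {ϖ}) (hπϖ : π ∈ Ideal.span {ϖ})
    (hO : ∀ a : O', a ^ q ^ r - a ∈ Ideal.span {ϖ}) :
    ∃! u : ℕ → MvPolynomial ℕ O',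
      ∀ m : ℕ, wittPhi (MvPolynomial.C ϖ) (q ^ r) m u
        = wittPhi (MvPolynomial.C π) q (r * m) (fun i => MvPolynomial.X i) := by
  simp only [Ideal.mem_span_singleton] at hpϖ hπϖ hO
  have hQ : q ^ r = p ^ (h * r) := by rw [hq, pow_mul]
  have hG := C_pow_dvd_wittPhi_X_sub_expand hπϖ q hr
  rw [hQ] at hO hG ⊢
  have hpC : (C ϖ : MvPolynomial ℕ O') ∣ (p : MvPolynomial ℕ O') := by
    simpa using map_dvd (C : O' →+* MvPolynomial ℕ O') hpϖ
  obtain ⟨u, hu⟩ := exists_wittPhi_eq_s5 (Nat.mul_pos hh hr) hpC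
    (expand (p ^ (h * r)) : MvPolynomial ℕ O' →ₐ[O'] MvPolynomial ℕ O').toRingHom
    (expand_C _ ϖ) (MvPolynomial.C_dvd_pow_sub_expand hp hpϖ hO)
    (G := fun m => wittPhi (C π) q (r * m) fun i => X i) hG
  exact ⟨u, hu, fun v hv => wittPhi_injective_s5 (C_ne_zero.2 hϖ) _ fun n =>
    (hv n).trans (hu n).symm⟩
end
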